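/- The Kullback-Leibler divergence between two Dirichlet distributions Dir(α) and Dir(α̂) (both with C categories) equals log B(α̂) - log B(α) + Σ_{i=1}^C (α_i - α̂_i)[ψ(α_i) - ψ(α_0)], where α_0 = Σ_i α_i, B is the multivariate Beta function B(α) = Π_i Γ(α_i) / Γ(α_0), and ψ is the digamma function. -/

import Mathlib

open MeasureTheory Real BigOperators

/-- The digamma function `ψ = (log ∘ Γ)'`. -/
noncomputable def digamma (x : ℝ) : ℝ := deriv (fun y => Real.log (Real.Gamma y)) x

/-- The trigamma function `ψ₁ = ψ'`. -/
noncomputable def trigamma (x : ℝ) : ℝ := deriv digamma x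

/-- The multivariate Beta function `B(α) = (∏ᵢ Γ(αᵢ)) / Γ(∑ᵢ αᵢ)`. -/
noncomputable def mvBeta {C : ℕ} (α : Fin C → ℝ) : ℝ :=
  (∏ i, Real.Gamma (α i)) / Real.Gamma (∑ i, α i)

/-- The Dirichlet density `D(p | α) = (1 / B(α)) ∏ᵢ pᵢ^(αᵢ - 1)`. -/
noncomputable def dirichletDensity {C : ℕ} (α p : Fin C → ℝ) : ℝ :=
  (∏ i, p i ^ (α i - 1)) / mvBeta α

/-- Expectation `E_{p ~ Dir(α)}[g p]` for a Dirichlet distribution with `C + 1` categories,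
written as an integral over the first `C` coordinates (the last coordinate being
`1 - ∑` of the others), against the Dirichlet density on the simplex. -/
noncomputable def dirichletExp {C : ℕ} (α : Fin (C + 1) → ℝ) (g : (Fin (C + 1) → ℝ) → ℝ) : ℝ :=
  ∫ x : Fin C → ℝ,
    Set.indicator {x : Fin C → ℝ | (∀ i, 0 ≤ x i) ∧ ∑ i, x i ≤ 1}
      (fun x =>
        dirichletDensity α (Fin.snoc x (1 - ∑ i, x i)) *
          g (Fin.snoc x (1 - ∑ i, x i))) x

/-- Kullback–Leibler divergence `KL(Dir(α) ‖ Dir(α̂)) = E_{p ~ Dir(α)}[log (D(p|α)/D(p|α̂))]`. -/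
noncomputable def dirichletKL {C : ℕ} (α αhat : Fin (C + 1) → ℝ) : ℝ :=
  dirichletExp α (fun p => Real.log (dirichletDensity α p / dirichletDensity αhat p))

/-- Differential entropy `H(Dir(α)) = E_{p ~ Dir(α)}[- log D(p|α)]`. -/
noncomputable def dirichletEntropy {C : ℕ} (α : Fin (C + 1) → ℝ) : ℝ :=
  dirichletExp α (fun p => - Real.log (dirichletDensity α p))

theorem lintegral_fin_prod_eq_prod_lintegral {n : ℕ} {f : Fin n → ℝ → ENNReal}
    (hf : ∀ i, Measurable (f i)) :
    ∫⁻ x : Fin n → ℝ, ∏ i, f i (x i) = ∏ i, ∫⁻ t, f i t := by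
  induction n with
  | zero => simp [volume_pi]
  | succ n ih =>
    rw [← ((volume_preserving_piFinSuccAbove (fun _ : Fin (n + 1) => ℝ) 0).symm).lintegral_comp_emb
      (MeasurableEquiv.measurableEmbedding _)]
    simp_rw [MeasurableEquiv.piFinSuccAbove_symm_apply, Fin.insertNthEquiv, Fin.prod_univ_succ,
      Fin.insertNth_zero]
    simp only [Equiv.coe_fn_mk, Fin.cons_zero, Fin.cons_succ]
    rw [← ih (fun i => hf i.succ)]
    exact lintegral_prod_mul (hf 0).aemeasurable
      (Finset.measurable_prod _ fun (i : Fin n) _ => (hf i.succ).comp (measurable_pi_apply i)).aemeasurable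

theorem ofReal_pow_mul_lintegral_comp_smul {C : ℕ} {f : (Fin C → ℝ) → ENNReal}
    (hf : Measurable f) {s : ℝ} (hs : 0 < s) :
    ENNReal.ofReal (s ^ C) * ∫⁻ x, f (s • x) = ∫⁻ x, f x := by
  have h := lintegral_map (μ := volume) hf (measurable_const_smul s)
  rw [Measure.map_addHaar_smul volume hs.ne', lintegral_smul_measure, Module.finrank_fin_fun,
    abs_of_pos (by positivity), smul_eq_mul] at h
  rw [← h, ← mul_assoc, ← ENNReal.ofReal_mul (by positivity), mul_inv_cancel₀ (by positivity),
    ENNReal.ofReal_one, one_mul]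

/-- The function `y ↦ y ^ a` on the positive half-line, extended by zero. -/
noncomputable def posRpow (a y : ℝ) : ENNReal := if 0 < y then ENNReal.ofReal (y ^ a) else 0

theorem posRpow_of_pos {a y : ℝ} (hy : 0 < y) : posRpow a y = ENNReal.ofReal (y ^ a) := if_pos hy

theorem posRpow_of_nonpos {a y : ℝ} (hy : y ≤ 0) : posRpow a y = 0 := if_neg hy.not_gt

@[fun_prop]
theorem measurable_posRpow (a : ℝ) : Measurable (posRpow a) :=
  Measurable.ite measurableSet_Ioi (by fun_prop) measurable_const

theorem posRpow_mul {a s : ℝ} (hs : 0 < s) (y : ℝ) :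
    posRpow a (s * y) = ENNReal.ofReal (s ^ a) * posRpow a y := by
  rcases lt_or_ge 0 y with hy | hy
  · rw [posRpow_of_pos hy, posRpow_of_pos (mul_pos hs hy), Real.mul_rpow hs.le hy.le,
      ENNReal.ofReal_mul (by positivity)]
  · rw [posRpow_of_nonpos hy, posRpow_of_nonpos (mul_nonpos_of_nonneg_of_nonpos hs.le hy),
      mul_zero]

theorem posRpow_mul_ofReal_exp_log (a t y : ℝ) :
    posRpow a y * ENNReal.ofReal (Real.exp (t * Real.log y)) = posRpow (a + t) y := by
  rcases lt_or_ge 0 y with hy | hy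
  · rw [posRpow_of_pos hy, posRpow_of_pos hy, Real.rpow_add hy,
      ENNReal.ofReal_mul (by positivity), mul_comm t, ← Real.rpow_def_of_pos hy]
  · rw [posRpow_of_nonpos hy, posRpow_of_nonpos hy, zero_mul]

theorem lintegral_posRpow_mul_exp_neg {a : ℝ} (ha : 0 < a) :
    ∫⁻ y, posRpow (a - 1) y * ENNReal.ofReal (Real.exp (-y)) = ENNReal.ofReal (Real.Gamma a) := by
  rw [Real.Gamma_eq_integral ha, ofReal_integral_eq_lintegral_ofReal
    (Real.GammaIntegral_convergent ha), ← lintegral_indicator measurableSet_Ioi]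
  · refine lintegral_congr fun y => ?_
    by_cases hy : 0 < y
    · rw [Set.indicator_of_mem (Set.mem_Ioi.2 hy), posRpow_of_pos hy,
        ENNReal.ofReal_mul (by positivity), mul_comm]
    · rw [Set.indicator_of_notMem (by simpa using hy), posRpow_of_nonpos (not_lt.1 hy), zero_mul]
  · filter_upwards [ae_restrict_mem measurableSet_Ioi] with y hy
    have : 0 < y := hy
    simp only [Pi.zero_apply]
    positivity

/-- The unnormalized Dirichlet density `∏ pᵢ ^ (αᵢ - 1)` on the open positive orthant, extended
by zero. -/
noncomputable def dirichletWeight {n : ℕ} (α p : Fin n → ℝ) : ENNReal :=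
  ∏ i, posRpow (α i - 1) (p i)

@[fun_prop]
theorem measurable_dirichletWeight {n : ℕ} (α : Fin n → ℝ) : Measurable (dirichletWeight α) :=
  Finset.measurable_prod _ fun i _ => (measurable_posRpow _).comp (measurable_pi_apply i)

theorem dirichletWeight_of_pos {n : ℕ} (α : Fin n → ℝ) {p : Fin n → ℝ} (hp : ∀ i, 0 < p i) :
    dirichletWeight α p = ENNReal.ofReal (∏ i, p i ^ (α i - 1)) := by
  rw [ENNReal.ofReal_prod_of_nonneg fun i _ => Real.rpow_nonneg (hp i).le _]
  exact Finset.prod_congr rfl fun i _ => posRpow_of_pos (hp i)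

theorem dirichletWeight_of_nonpos {n : ℕ} (α : Fin n → ℝ) {p : Fin n → ℝ} {i : Fin n}
    (hp : p i ≤ 0) : dirichletWeight α p = 0 :=
  Finset.prod_eq_zero (Finset.mem_univ i) (posRpow_of_nonpos hp)

theorem dirichletWeight_lt_top {n : ℕ} (α p : Fin n → ℝ) : dirichletWeight α p < ⊤ :=
  ENNReal.prod_lt_top fun i _ => by
    unfold posRpow
    split_ifs <;> simp

theorem dirichletWeight_smul {n : ℕ} (α p : Fin n → ℝ) {s : ℝ} (hs : 0 < s) :
    dirichletWeight α (s • p) =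
      ENNReal.ofReal (s ^ ∑ i, (α i - 1)) * dirichletWeight α p := by
  simp only [dirichletWeight, Pi.smul_apply, smul_eq_mul, posRpow_mul hs, Finset.prod_mul_distrib]
  rw [Real.rpow_sum_of_pos hs,
    ENNReal.ofReal_prod_of_nonneg fun i _ => Real.rpow_nonneg hs.le _]

theorem dirichletWeight_mul_exp_log {n : ℕ} (α p : Fin n → ℝ) (k : Fin n) (t : ℝ) :
    dirichletWeight α p * ENNReal.ofReal (Real.exp (t * Real.log (p k))) =
      dirichletWeight (Function.update α k (α k + t)) p := by
  have h (β : Fin n → ℝ) : dirichletWeight β p =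
      posRpow (β k - 1) (p k) * ∏ i ∈ Finset.univ.erase k, posRpow (β i - 1) (p i) :=
    (Finset.mul_prod_erase _ _ (Finset.mem_univ k)).symm
  rw [h α, h, mul_right_comm, posRpow_mul_ofReal_exp_log, Function.update_self,
    sub_add_eq_add_sub]
  congr 1
  refine Finset.prod_congr rfl fun i hi => ?_
  rw [Function.update_of_ne (Finset.ne_of_mem_erase hi)]

/-- The vector whose first coordinates are `x` and whose coordinates sum to `s`. -/
noncomputable def snocWithSum {C : ℕ} (s : ℝ) (x : Fin C → ℝ) : Fin (C + 1) → ℝ :=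
  Fin.snoc (α := fun _ => ℝ) x (s - ∑ i, x i)

theorem measurable_uncurry_snocWithSum {C : ℕ} :
    Measurable fun q : (Fin C → ℝ) × ℝ => snocWithSum q.2 q.1 := by
  refine measurable_pi_iff.2 fun i => ?_
  induction i using Fin.lastCases <;> simp only [snocWithSum, Fin.snoc_last, Fin.snoc_castSucc] <;>
    fun_prop

@[fun_prop]
theorem measurable_snocWithSum {C : ℕ} (s : ℝ) :
    Measurable (snocWithSum s : (Fin C → ℝ) → Fin (C + 1) → ℝ) :=
  measurable_uncurry_snocWithSum.comp (measurable_id.prodMk measurable_const)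

theorem sum_snocWithSum {C : ℕ} (s : ℝ) (x : Fin C → ℝ) : ∑ i, snocWithSum s x i = s := by
  simp [snocWithSum, Fin.sum_univ_castSucc]

theorem snocWithSum_smul {C : ℕ} (s : ℝ) (x : Fin C → ℝ) :
    snocWithSum s (s • x) = s • snocWithSum 1 x := by
  ext i
  induction i using Fin.lastCases <;> simp [snocWithSum, ← Finset.mul_sum, mul_sub]

theorem lintegral_dirichletWeight_snocWithSum {C : ℕ} (α : Fin (C + 1) → ℝ) (s : ℝ) :
    ∫⁻ x, dirichletWeight α (snocWithSum s x) =
      posRpow (∑ i, α i - 1) s * ∫⁻ x, dirichletWeight α (snocWithSum 1 x) := by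
  rcases lt_or_ge 0 s with hs | hs
  · rw [← ofReal_pow_mul_lintegral_comp_smul (by fun_prop) hs]
    simp_rw [snocWithSum_smul, dirichletWeight_smul α _ hs]
    rw [lintegral_const_mul _ (by fun_prop), ← mul_assoc, ← ENNReal.ofReal_mul (by positivity),
      posRpow_of_pos hs, ← Real.rpow_natCast, ← Real.rpow_add hs]
    have : (C : ℝ) + ∑ i, (α i - 1) = ∑ i, α i - 1 := by
      simp
      ring
    rw [this]
  · rw [posRpow_of_nonpos hs, zero_mul]
    refine (lintegral_congr fun x => ?_).trans lintegral_zero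
    obtain ⟨i, -, hi⟩ := Finset.exists_le_of_sum_le (f := snocWithSum s x) (g := 0)
      (Finset.univ_nonempty (α := Fin (C + 1))) (by simpa [sum_snocWithSum] using hs)
    exact dirichletWeight_of_nonpos α hi

theorem lintegral_dirichletWeight {C : ℕ} {α : Fin (C + 1) → ℝ} (hα : ∀ i, 0 < α i) :
    ∫⁻ x, dirichletWeight α (snocWithSum 1 x) = ENNReal.ofReal (mvBeta α) := by
  set h : ℝ → ℝ → ENNReal := fun a y => posRpow (a - 1) y * ENNReal.ofReal (Real.exp (-y)) with hh
  have hmeas (a : ℝ) : Measurable (h a) := by fun_prop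
  have hsum : 0 < ∑ i, α i := Finset.sum_pos (fun i _ => hα i) Finset.univ_nonempty
  have hprod (x : Fin C → ℝ) (s : ℝ) :
      (∏ i : Fin C, h (α i.castSucc) (x i)) * h (α (Fin.last C)) (s - ∑ i, x i) =
        dirichletWeight α (snocWithSum s x) * ENNReal.ofReal (Real.exp (-s)) := by
    have h1 : (∏ i : Fin C, h (α i.castSucc) (x i)) * h (α (Fin.last C)) (s - ∑ i, x i) =
        ∏ i, h (α i) (snocWithSum s x i) := by
      simp [Fin.prod_univ_castSucc, snocWithSum]
    rw [h1]
    simp only [hh, Finset.prod_mul_distrib]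
    rw [← ENNReal.ofReal_prod_of_nonneg fun i _ => (Real.exp_pos _).le, ← Real.exp_sum,
      Finset.sum_neg_distrib, sum_snocWithSum, dirichletWeight]
  have key : ∏ i, ENNReal.ofReal (Real.Gamma (α i)) =
      ENNReal.ofReal (Real.Gamma (∑ i, α i)) *
        ∫⁻ x, dirichletWeight α (snocWithSum 1 x) := calc
    _ = (∫⁻ x : Fin C → ℝ, ∏ i, h (α i.castSucc) (x i)) * ∫⁻ t, h (α (Fin.last C)) t := by
      rw [lintegral_fin_prod_eq_prod_lintegral fun i => hmeas _, Fin.prod_univ_castSucc]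
      simp only [hh, lintegral_posRpow_mul_exp_neg (hα _)]
    _ = ∫⁻ x : Fin C → ℝ, ∫⁻ s,
          dirichletWeight α (snocWithSum s x) * ENNReal.ofReal (Real.exp (-s)) := by
      rw [← lintegral_mul_const _ (by fun_prop)]
      refine lintegral_congr fun x => ?_
      simp_rw [← hprod]
      rw [lintegral_const_mul _ (by fun_prop), lintegral_sub_right_eq_self]
    _ = ∫⁻ s, ∫⁻ x : Fin C → ℝ,
          dirichletWeight α (snocWithSum s x) * ENNReal.ofReal (Real.exp (-s)) := by
      refine lintegral_lintegral_swap (Measurable.aemeasurable ?_)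
      exact ((measurable_dirichletWeight α).comp measurable_uncurry_snocWithSum).mul (by fun_prop)
    _ = _ := by
      rw [← lintegral_posRpow_mul_exp_neg hsum, ← lintegral_mul_const _ (by fun_prop)]
      refine lintegral_congr fun s => ?_
      rw [lintegral_mul_const _ (by fun_prop), lintegral_dirichletWeight_snocWithSum,
        mul_right_comm]
  have hΓ := Real.Gamma_pos_of_pos hsum
  rw [mvBeta, ENNReal.ofReal_div_of_pos hΓ,
    ENNReal.ofReal_prod_of_nonneg fun i _ => (Real.Gamma_pos_of_pos (hα i)).le, key,
    ENNReal.eq_div_iff (by simpa using hΓ) ENNReal.ofReal_ne_top]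

theorem ae_snocWithSum_ne_zero {C : ℕ} :
    ∀ᵐ x : Fin C → ℝ, ∀ i, snocWithSum 1 x i ≠ 0 := by
  refine ae_all_iff.2 fun i => ?_
  induction i using Fin.lastCases with
  | cast i => simpa [snocWithSum, volume_pi] using
      Measure.ae_eval_ne (fun _ : Fin C => (volume : Measure ℝ)) i 0
  | last =>
    rcases C with - | C
    · refine .of_forall fun x => ?_
      rw [snocWithSum, Fin.snoc_last]
      simp
    · let L : (Fin (C + 1) → ℝ) →ₗ[ℝ] ℝ := ∑ i, LinearMap.proj i
      have hL : Function.Surjective L := fun y => ⟨Pi.single 0 y, by simp [L]⟩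
      have h := (ae_comp_linearMap_mem_iff L volume volume hL
        (s := {(1 : ℝ)}ᶜ) (measurableSet_singleton _).compl).2 (by simp [ae_iff])
      filter_upwards [h] with x hx
      have hx' : ∑ i, x i ≠ 1 := by simpa [L] using hx
      rw [snocWithSum, Fin.snoc_last]
      exact sub_ne_zero.2 hx'.symm

theorem hasDerivAt_Gamma_of_pos {x : ℝ} (hx : 0 < x) :
    HasDerivAt Real.Gamma (Real.Gamma x * digamma x) x := by
  have hd : DifferentiableAt ℝ Real.Gamma x :=
    Real.differentiableAt_Gamma fun m => by
      have : (0 : ℝ) ≤ m := m.cast_nonneg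
      linarith
  have hΓ := (Real.Gamma_pos_of_pos hx).ne'
  rw [digamma, deriv.log hd hΓ, mul_div_cancel₀ _ hΓ]
  exact hd.hasDerivAt

theorem mvBeta_pos {n : ℕ} {α : Fin (n + 1) → ℝ} (hα : ∀ i, 0 < α i) : 0 < mvBeta α :=
  div_pos (Finset.prod_pos fun i _ => Real.Gamma_pos_of_pos (hα i))
    (Real.Gamma_pos_of_pos (Finset.sum_pos (fun i _ => hα i) Finset.univ_nonempty))

theorem hasDerivAt_mvBeta_update {n : ℕ} {α : Fin (n + 1) → ℝ} (hα : ∀ i, 0 < α i)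
    (k : Fin (n + 1)) :
    HasDerivAt (fun t => mvBeta (Function.update α k (α k + t)))
      (mvBeta α * (digamma (α k) - digamma (∑ i, α i))) 0 := by
  have hsum : 0 < ∑ i, α i := Finset.sum_pos (fun i _ => hα i) Finset.univ_nonempty
  have hΓ := (Real.Gamma_pos_of_pos hsum).ne'
  have heq (t : ℝ) : mvBeta (Function.update α k (α k + t)) =
      Real.Gamma (α k + t) * (∏ i ∈ Finset.univ.erase k, Real.Gamma (α i)) /
        Real.Gamma (∑ i, α i + t) := by
    rw [mvBeta, ← Finset.mul_prod_erase _ _ (Finset.mem_univ k),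
      ← Finset.add_sum_erase _ _ (Finset.mem_univ k), Function.update_self,
      Finset.prod_congr rfl fun i hi => by
        rw [Function.update_of_ne (Finset.ne_of_mem_erase hi)],
      Finset.sum_congr rfl fun i hi => Function.update_of_ne (Finset.ne_of_mem_erase hi) _ _,
      ← Finset.add_sum_erase _ α (Finset.mem_univ k), add_right_comm]
  have hshift {a : ℝ} (ha : 0 < a) :
      HasDerivAt (fun t => Real.Gamma (a + t)) (Real.Gamma a * digamma a) 0 := by
    have h : HasDerivAt Real.Gamma (Real.Gamma a * digamma a) (a + 0) := by
      simpa using hasDerivAt_Gamma_of_pos ha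
    exact h.comp_const_add a 0
  simp_rw [heq]
  refine (((hshift (hα k)).mul_const _).div (hshift hsum) (by simpa using hΓ)).congr_deriv ?_
  rw [mvBeta, ← Finset.mul_prod_erase _ _ (Finset.mem_univ k), add_zero, add_zero]
  field_simp

/-- The measure on the first `C` coordinates of the simplex whose density is the unnormalized
Dirichlet density. -/
noncomputable def dirichletMeasure {C : ℕ} (α : Fin (C + 1) → ℝ) : Measure (Fin C → ℝ) :=
  volume.withDensity fun x => dirichletWeight α (snocWithSum 1 x)

theorem dirichletMeasure_univ {C : ℕ} {α : Fin (C + 1) → ℝ} (hα : ∀ i, 0 < α i) :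
    dirichletMeasure α Set.univ = ENNReal.ofReal (mvBeta α) := by
  rw [dirichletMeasure, withDensity_apply _ MeasurableSet.univ, Measure.restrict_univ,
    lintegral_dirichletWeight hα]

theorem lintegral_exp_mul_log_dirichletMeasure {C : ℕ} {α : Fin (C + 1) → ℝ} (hα : ∀ i, 0 < α i)
    (k : Fin (C + 1)) {t : ℝ} (ht : 0 < α k + t) :
    ∫⁻ x, ENNReal.ofReal (Real.exp (t * Real.log (snocWithSum 1 x k))) ∂dirichletMeasure α =
      ENNReal.ofReal (mvBeta (Function.update α k (α k + t))) := by
  rw [dirichletMeasure, lintegral_withDensity_eq_lintegral_mul _ (by fun_prop) (by fun_prop)]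
  simp only [Pi.mul_apply, dirichletWeight_mul_exp_log]
  refine lintegral_dirichletWeight fun i => ?_
  rcases eq_or_ne i k with rfl | hi
  · simpa using ht
  · simpa [hi] using hα i

theorem zero_mem_interior_integrableExpSet_log {C : ℕ} {α : Fin (C + 1) → ℝ}
    (hα : ∀ i, 0 < α i) (k : Fin (C + 1)) :
    0 ∈ interior (ProbabilityTheory.integrableExpSet
      (fun x => Real.log (snocWithSum 1 x k)) (dirichletMeasure α)) := by
  refine mem_interior.2 ⟨Set.Ioi (-α k), fun t ht => ?_, isOpen_Ioi, by simpa using hα k⟩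
  have ht' : 0 < α k + t := by linarith [Set.mem_Ioi.1 ht]
  refine (lintegral_ofReal_ne_top_iff_integrable
    (Measurable.aestronglyMeasurable (by fun_prop)) (.of_forall fun x => (Real.exp_pos _).le)).1 ?_
  rw [lintegral_exp_mul_log_dirichletMeasure hα k ht']
  exact ENNReal.ofReal_ne_top

theorem integral_log_dirichletMeasure {C : ℕ} {α : Fin (C + 1) → ℝ} (hα : ∀ i, 0 < α i)
    (k : Fin (C + 1)) :
    ∫ x, Real.log (snocWithSum 1 x k) ∂dirichletMeasure α =
      mvBeta α * (digamma (α k) - digamma (∑ i, α i)) := by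
  rw [← ProbabilityTheory.deriv_mgf_zero (zero_mem_interior_integrableExpSet_log hα k),
    ← (hasDerivAt_mvBeta_update hα k).deriv]
  refine Filter.EventuallyEq.deriv_eq ?_
  filter_upwards [Ioi_mem_nhds (neg_lt_zero.2 (hα k))] with t ht
  have ht' : 0 < α k + t := by linarith [Set.mem_Ioi.1 ht]
  rw [ProbabilityTheory.mgf, integral_eq_lintegral_of_nonneg_ae
    (.of_forall fun x => (Real.exp_pos _).le) (Measurable.aestronglyMeasurable (by fun_prop)),
    lintegral_exp_mul_log_dirichletMeasure hα k ht', ENNReal.toReal_ofReal (mvBeta_pos _).le]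
  intro i
  rcases eq_or_ne i k with rfl | hi
  · simpa using ht'
  · simpa [hi] using hα i

theorem log_dirichletDensity {C : ℕ} {α p : Fin (C + 1) → ℝ} (hα : ∀ i, 0 < α i)
    (hp : ∀ i, 0 < p i) :
    Real.log (dirichletDensity α p) =
      ∑ i, (α i - 1) * Real.log (p i) - Real.log (mvBeta α) := by
  have h (i : Fin (C + 1)) : p i ^ (α i - 1) ≠ 0 := (Real.rpow_pos_of_pos (hp i) _).ne'
  rw [dirichletDensity, Real.log_div (Finset.prod_ne_zero_iff.2 fun i _ => h i) (mvBeta_pos hα).ne',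
    Real.log_prod fun i _ => h i]
  simp only [Real.log_rpow (hp _)]

theorem dirichletDensity_pos {C : ℕ} {α p : Fin (C + 1) → ℝ} (hα : ∀ i, 0 < α i)
    (hp : ∀ i, 0 < p i) : 0 < dirichletDensity α p :=
  div_pos (Finset.prod_pos fun i _ => Real.rpow_pos_of_pos (hp i) _) (mvBeta_pos hα)

theorem dirichletExp_eq_integral_dirichletMeasure {C : ℕ} (α : Fin (C + 1) → ℝ)
    {g g' : (Fin (C + 1) → ℝ) → ℝ} (hg : ∀ p, (∀ i, 0 < p i) → g p = g' p) :
    dirichletExp α g = (mvBeta α)⁻¹ * ∫ x, g' (snocWithSum 1 x) ∂dirichletMeasure α := by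
  rw [dirichletMeasure, integral_withDensity_eq_integral_toReal_smul (by fun_prop)
    (.of_forall fun x => dirichletWeight_lt_top α _), ← integral_const_mul, dirichletExp]
  refine integral_congr_ae ?_
  filter_upwards [ae_snocWithSum_ne_zero] with x hx
  change Set.indicator _ (fun x => dirichletDensity α (snocWithSum 1 x) * g (snocWithSum 1 x)) x = _
  by_cases hpos : ∀ i, 0 < snocWithSum 1 x i
  · rw [Set.indicator_of_mem, dirichletWeight_of_pos α hpos, ENNReal.toReal_ofReal
      (Finset.prod_nonneg fun i _ => Real.rpow_nonneg (hpos i).le _), hg _ hpos, dirichletDensity,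
      smul_eq_mul]
    · ring
    · refine ⟨fun i => by simpa [snocWithSum] using (hpos i.castSucc).le, ?_⟩
      simpa [snocWithSum] using (hpos (Fin.last C)).le
  · obtain ⟨i, hi⟩ := not_forall.1 hpos
    rw [dirichletWeight_of_nonpos α (not_lt.1 hi), Set.indicator_of_notMem]
    · simp
    · rintro ⟨h1, h2⟩
      refine hi (lt_of_le_of_ne ?_ (hx i).symm)
      induction i using Fin.lastCases with
      | cast i => simpa [snocWithSum] using h1 i
      | last => simpa [snocWithSum] using h2

/-- Closed form of the KL divergence between two Dirichlet distributions:
`KL(Dir(α) ‖ Dir(α̂)) = log B(α̂) - log B(α) + ∑ i, (αᵢ - α̂ᵢ)(ψ(αᵢ) - ψ(α₀))`. -/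
theorem dirichlet_KL_closed_form
    (C : ℕ) (α αhat : Fin (C + 1) → ℝ)
    (hα : ∀ i, 0 < α i) (hαhat : ∀ i, 0 < αhat i) :
    dirichletKL α αhat =
      Real.log (mvBeta αhat) - Real.log (mvBeta α) +
        ∑ i, (α i - αhat i) * (digamma (α i) - digamma (∑ j, α j)) := by
  have hB := mvBeta_pos hα
  rw [dirichletKL, dirichletExp_eq_integral_dirichletMeasure α
    (g' := fun p => (Real.log (mvBeta αhat) - Real.log (mvBeta α)) +
      ∑ i, (α i - αhat i) * Real.log (p i))]
  · have hfin : IsFiniteMeasure (dirichletMeasure α) :=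
      ⟨by rw [dirichletMeasure_univ hα]; exact ENNReal.ofReal_lt_top⟩
    have hint (i : Fin (C + 1)) : Integrable
        (fun x => (α i - αhat i) * Real.log (snocWithSum 1 x i)) (dirichletMeasure α) :=
      (ProbabilityTheory.integrable_of_mem_interior_integrableExpSet
        (zero_mem_interior_integrableExpSet_log hα i)).const_mul _
    rw [integral_add (integrable_const _) (integrable_finsetSum _ fun i _ => hint i),
      integral_finsetSum _ fun i _ => hint i, integral_const, measureReal_def,
      dirichletMeasure_univ hα, ENNReal.toReal_ofReal hB.le, smul_eq_mul, mul_add,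
      inv_mul_cancel_left₀ hB.ne', Finset.mul_sum]
    congr 1
    refine Finset.sum_congr rfl fun i _ => ?_
    rw [integral_const_mul, integral_log_dirichletMeasure hα]
    field_simp
  · intro p hp
    rw [Real.log_div (dirichletDensity_pos hα hp).ne' (dirichletDensity_pos hαhat hp).ne',
      log_dirichletDensity hα hp, log_dirichletDensity hαhat hp, sub_sub_sub_comm,
      ← Finset.sum_sub_distrib, sub_eq_neg_add, neg_sub]
    congr 1
    refine Finset.sum_congr rfl fun i _ => ?_
    ring
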